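/- Let q be a complex number with 0 < |q| < 1 and let b be a complex number with 1 + b q^N ≠ 0 for every positive integer N. Then for all positive integers m and n, the absolutely convergent sum over all n-tuples (a_1, …, a_n) of nonnegative integers with a_1 ≤ a_2 ≤ ⋯ ≤ a_n of q^{m(a_1 + a_2 + ⋯ + a_n)} / ∏_{j=1}^{n} ∏_{k=ε_j}^{m+1} (1 + b q^{(j−1)m + k + a_j}) equals 1 / ((q^m; q^m)_n · (−bq; q)_{mn}), where ε_1 = 1 and, for 2 ≤ j ≤ n, ε_j = 2 if a_j = a_{j−1} and ε_j = 1 otherwise. -/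

import Mathlib

/-- The finite q-Pochhammer symbol `(a; q)_n = ∏_{j=0}^{n-1} (1 - a q^j)`. -/
noncomputable def qPoch (a q : ℂ) (n : ℕ) : ℂ := ∏ j ∈ Finset.range n, (1 - a * q ^ j)

/-- The lower limit `ε_j` of the inner product in Lemma 3.2: `ε_1 = 1`, and for
`j ≥ 2`, `ε_j = 2` if `a_j = a_{j-1}` and `ε_j = 1` otherwise. -/
def eps4 {n : ℕ} (a : Fin n → ℕ) (j : Fin n) : ℕ :=
  if h : (j : ℕ) = 0 then 1
  else if a j = a ⟨(j : ℕ) - 1,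
      lt_trans (Nat.sub_lt (Nat.pos_of_ne_zero h) one_pos) j.isLt⟩ then 2 else 1

open Filter Topology Finset

/-- Prepending a smallest entry: a weakly increasing `(n+1)`-tuple is its first entry together with
the weakly increasing tuple of the differences of the other entries to it. -/
def monotoneConsEquiv (n : ℕ) :
    ℕ × {a : Fin n → ℕ // Monotone a} ≃ {a : Fin (n + 1) → ℕ // Monotone a} where
  toFun p := ⟨Fin.cons p.1 fun i => p.1 + p.2.1 i, by
    intro i j hij
    induction i using Fin.cases with
    | zero =>
      induction j using Fin.cases with
      | zero => exact le_rfl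
      | succ j => simp
    | succ i =>
      induction j using Fin.cases with
      | zero => exact absurd hij (by simp)
      | succ j => simpa using p.2.2 (Fin.succ_le_succ_iff.1 hij)⟩
  invFun a := ⟨a.1 0, fun i => a.1 i.succ - a.1 0, fun _ _ hij =>
    Nat.sub_le_sub_right (a.2 (Fin.succ_le_succ_iff.2 hij)) _⟩
  left_inv := by
    rintro ⟨s, a, ha⟩
    simp
  right_inv := by
    rintro ⟨a, ha⟩
    ext i
    induction i using Fin.cases with
    | zero => simp
    | succ i => simpa using Nat.add_sub_cancel' (ha (Fin.zero_le i.succ))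

/-- The summand attached to the tuple `a`. -/
noncomputable def tupleTerm (q b : ℂ) (m : ℕ) {n : ℕ} (a : Fin n → ℕ) : ℂ :=
  q ^ (m * ∑ j, a j) /
    ∏ j : Fin n, ∏ k ∈ Finset.Icc (eps4 a j) (m + 1), (1 + b * q ^ ((j : ℕ) * m + k + a j))

lemma qPoch_neg_mul (c q : ℂ) (N : ℕ) :
    qPoch (-(c * q)) q N = ∏ j ∈ range N, (1 + c * q ^ (j + 1)) :=
  prod_congr rfl fun j _ => by ring

lemma qPoch_succ (a q : ℂ) (N : ℕ) : qPoch a q (N + 1) = qPoch a q N * (1 - a * q ^ N) :=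
  prod_range_succ _ _

lemma qPoch_add (a q : ℂ) (M N : ℕ) :
    qPoch a q (M + N) = qPoch a q M * qPoch (a * q ^ M) q N := by
  simp only [qPoch, prod_range_add, pow_add, mul_assoc]

lemma prod_Icc_eq_qPoch (c q : ℂ) (s N : ℕ) :
    ∏ k ∈ Icc 1 N, (1 + c * q ^ (k + s)) = qPoch (-(c * q ^ s * q)) q N := by
  rw [qPoch_neg_mul, range_eq_Ico, prod_Ico_add' (fun k => 1 + c * q ^ s * q ^ k) 0 N 1]
  refine prod_congr (by ext; simp) fun k _ => by ring

lemma qPoch_ne_zero {q c : ℂ} (hc : ∀ N : ℕ, 0 < N → 1 + c * q ^ N ≠ 0) (N : ℕ) :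
    qPoch (-(c * q)) q N ≠ 0 := by
  rw [qPoch_neg_mul]
  exact prod_ne_zero_iff.2 fun j _ => hc _ j.succ_pos

lemma one_sub_pow_ne_zero {q : ℂ} (hq : ‖q‖ < 1) {M : ℕ} (hM : 0 < M) : 1 - q ^ M ≠ 0 := by
  intro h
  have h1 : ‖q ^ M‖ < 1 := by
    rw [norm_pow]
    exact pow_lt_one₀ (norm_nonneg _) hq hM.ne'
  rw [← sub_eq_zero.1 h, norm_one] at h1
  exact lt_irrefl _ h1

lemma qPoch_pow_ne_zero {q : ℂ} (hq : ‖q‖ < 1) {m : ℕ} (hm : 0 < m) (n : ℕ) :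
    qPoch (q ^ m) (q ^ m) n ≠ 0 := by
  refine prod_ne_zero_iff.2 fun j _ => ?_
  rw [← pow_succ', ← pow_mul]
  exact one_sub_pow_ne_zero hq (by positivity)

lemma one_add_mul_pow_shift {q b : ℂ} (hb : ∀ N : ℕ, 0 < N → 1 + b * q ^ N ≠ 0) (s : ℕ) :
    ∀ N : ℕ, 0 < N → 1 + b * q ^ s * q ^ N ≠ 0 := fun N hN => by
  rw [mul_assoc, ← pow_add]
  exact hb _ (by omega)

lemma exists_norm_inv_le {q : ℂ} (hq : ‖q‖ < 1) (b : ℂ) :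
    ∃ K : ℝ, 1 ≤ K ∧ ∀ N : ℕ, 0 < N → ‖(1 + b * q ^ N)⁻¹‖ ≤ K := by
  have h : Tendsto (fun N : ℕ => ‖(1 + b * q ^ N)⁻¹‖) atTop (𝓝 ‖(1 + b * 0 : ℂ)⁻¹‖) :=
    ((((tendsto_pow_atTop_nhds_zero_of_norm_lt_one hq).const_mul b).const_add 1).inv₀
      (by simp)).norm
  obtain ⟨K, hK⟩ := h.bddAbove_range
  exact ⟨max 1 K, le_max_left _ _, fun N _ => (hK ⟨N, rfl⟩).trans (le_max_right _ _)⟩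

lemma summable_pow_sum {r : ℝ} (h0 : 0 ≤ r) (h1 : r < 1) (n : ℕ) :
    Summable fun a : Fin n → ℕ => r ^ ∑ j, a j := by
  induction n with
  | zero => exact Summable.of_finite
  | succ n ih =>
    rw [← (Fin.consEquiv fun _ => ℕ).summable_iff]
    refine ((summable_geometric_of_lt_one h0 h1).mul_of_nonneg ih (fun _ => by positivity)
      fun _ => by positivity).congr fun p => ?_
    simp [Fin.consEquiv, Fin.sum_univ_succ, pow_add]

lemma one_le_eps4 {n : ℕ} (a : Fin n → ℕ) (j : Fin n) : 1 ≤ eps4 a j := by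
  unfold eps4
  split_ifs <;> norm_num

lemma summable_tupleTerm {q : ℂ} (hq : ‖q‖ < 1) (b : ℂ) {m : ℕ} (hm : 0 < m) (n : ℕ) :
    Summable fun a : Fin n → ℕ => tupleTerm q b m a := by
  obtain ⟨K, hK1, hK⟩ := exists_norm_inv_le hq b
  refine Summable.of_norm_bounded (g := fun a => (‖q‖ ^ m) ^ (∑ j, a j) * (K ^ (m + 1)) ^ n)
    ((summable_pow_sum (by positivity) (pow_lt_one₀ (norm_nonneg _) hq hm.ne') n).mul_right _)
    fun a => ?_
  rw [tupleTerm, div_eq_mul_inv, norm_mul, norm_pow, pow_mul, ← prod_inv_distrib, norm_prod]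
  gcongr
  calc _ ≤ ∏ _j : Fin n, K ^ (m + 1) := by
        refine prod_le_prod (fun _ _ => norm_nonneg _) fun j _ => ?_
        rw [← prod_inv_distrib, norm_prod]
        calc _ ≤ ∏ _k ∈ Icc (eps4 a j) (m + 1), K :=
              prod_le_prod (fun _ _ => norm_nonneg _) fun k hk => hK _ (by
                have := one_le_eps4 a j
                have := (mem_Icc.1 hk).1
                omega)
          _ ≤ K ^ (m + 1) := by
              rw [prod_const, Nat.card_Icc]
              exact pow_le_pow_right₀ hK1 (by have := one_le_eps4 a j; omega)
    _ = _ := by simp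

/-- `q ^ (M * t) / (-c q ^ (t + 1); q)_(M + 1)` telescopes: up to the factor `1 - q ^ M` it is the
difference at `t` and `t + 1` of `q ^ (M * t) / (-c q ^ (t + 1); q)_M`. -/
lemma hasSum_pow_div_qPoch {q c : ℂ} (hq : ‖q‖ < 1) (hc : ∀ N : ℕ, 0 < N → 1 + c * q ^ N ≠ 0)
    {M : ℕ} (hM : 0 < M) :
    HasSum (fun t : ℕ => q ^ (M * t) / qPoch (-(c * q ^ t * q)) q (M + 1))
      (1 / ((1 - q ^ M) * qPoch (-(c * q)) q M)) := by
  obtain ⟨K, hK1, hK⟩ := exists_norm_inv_le hq c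
  set T : ℕ → ℂ := fun t => q ^ (M * t) / qPoch (-(c * q ^ t * q)) q M with hT
  have hsum : Summable T := by
    refine Summable.of_norm_bounded (g := fun t => (‖q‖ ^ M) ^ t * K ^ M)
      ((summable_geometric_of_lt_one (by positivity)
        (pow_lt_one₀ (norm_nonneg _) hq hM.ne')).mul_right _) fun t => ?_
    simp only [hT]
    rw [div_eq_mul_inv, norm_mul, norm_pow, pow_mul, qPoch_neg_mul, ← prod_inv_distrib, norm_prod]
    gcongr
    calc _ ≤ ∏ _j ∈ range M, K := by
          refine prod_le_prod (fun _ _ => norm_nonneg _) fun j _ => ?_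
          rw [mul_assoc, ← pow_add]
          exact hK _ (by omega)
      _ = K ^ M := by simp
  have htel := (hsum.hasSum.sub ((hasSum_nat_add_iff' 1).2 hsum.hasSum)).mul_left (1 - q ^ M)⁻¹
  have h1 := one_sub_pow_ne_zero hq hM
  have hfun : (fun t : ℕ => q ^ (M * t) / qPoch (-(c * q ^ t * q)) q (M + 1)) =
      fun t => (1 - q ^ M)⁻¹ * (T t - T (t + 1)) := by
    funext t
    have hct := one_add_mul_pow_shift hc t
    have e1 := qPoch_succ (-(c * q ^ t * q)) q M
    have e2 : qPoch (-(c * q ^ t * q)) q (M + 1)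
        = (1 + c * q ^ t * q) * qPoch (-(c * q ^ (t + 1) * q)) q M := by
      rw [add_comm, qPoch_add]
      congr 1
      · simp [qPoch]
      · congr 1
        ring
    have n0 := qPoch_ne_zero hct (M + 1)
    have n1 : qPoch (-(c * q ^ t * q)) q M ≠ 0 := qPoch_ne_zero hct M
    have n2 : qPoch (-(c * q ^ (t + 1) * q)) q M ≠ 0 :=
      qPoch_ne_zero (one_add_mul_pow_shift hc (t + 1)) M
    have d1 : T t = q ^ (M * t) * (1 - -(c * q ^ t * q) * q ^ M) /
        qPoch (-(c * q ^ t * q)) q (M + 1) := by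
      rw [eq_div_iff n0, e1, ← mul_assoc, hT, div_mul_cancel₀ _ n1]
    have d2 : T (t + 1) = q ^ (M * (t + 1)) * (1 + c * q ^ t * q) /
        qPoch (-(c * q ^ t * q)) q (M + 1) := by
      rw [eq_div_iff n0, e2, mul_left_comm, hT, div_mul_cancel₀ _ n2, mul_comm]
    rw [d1, d2, ← sub_div, ← mul_div_assoc]
    congr 1
    field_simp
    ring
  have hval : 1 / ((1 - q ^ M) * qPoch (-(c * q)) q M) =
      (1 - q ^ M)⁻¹ * (∑' t, T t - (∑' t, T t - ∑ i ∈ range 1, T i)) := by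
    rw [sub_sub_cancel, sum_range_one, hT, one_div, mul_inv]
    simp
  rw [hfun, hval]
  exact htel

/-- Splitting off the first entry of a tuple. -/
lemma tupleTerm_cons {q b : ℂ} (hb : ∀ N : ℕ, 0 < N → 1 + b * q ^ N ≠ 0) (m n s : ℕ)
    (a : Fin (n + 1) → ℕ) :
    tupleTerm q b m (Fin.cons s fun i => s + a i : Fin (n + 2) → ℕ) =
      q ^ (m * (n + 2) * s) / qPoch (-(b * q ^ s * q)) q (m + 1) *
        ((if a 0 = 0 then 1 + b * q ^ (m + s) * q else 1) * tupleTerm q (b * q ^ (m + s)) m a) := by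
  have hw : (if a 0 = 0 then 1 + b * q ^ (m + s) * q else 1) ≠ 0 := by
    split_ifs
    · simpa using one_add_mul_pow_shift hb (m + s) 1 one_pos
    · exact one_ne_zero
  have hexp : m * ∑ j, (Fin.cons s fun i => s + a i : Fin (n + 2) → ℕ) j =
      m * (n + 2) * s + m * ∑ j, a j := by
    rw [Fin.sum_univ_succ]
    simp [sum_add_distrib]
    ring
  have hhead : ∏ k ∈ Icc (eps4 (Fin.cons s fun i => s + a i : Fin (n + 2) → ℕ) 0) (m + 1),
      (1 + b * q ^ (((0 : Fin (n + 2)) : ℕ) * m + k +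
        (Fin.cons s fun i => s + a i : Fin (n + 2) → ℕ) 0)) =
      qPoch (-(b * q ^ s * q)) q (m + 1) := by
    rw [← prod_Icc_eq_qPoch]
    simp [eps4]
  have htail : (if a 0 = 0 then 1 + b * q ^ (m + s) * q else 1) *
      ∏ j : Fin (n + 1), ∏ k ∈
        Icc (eps4 (Fin.cons s fun i => s + a i : Fin (n + 2) → ℕ) j.succ) (m + 1),
        (1 + b * q ^ ((j.succ : ℕ) * m + k +
          (Fin.cons s fun i => s + a i : Fin (n + 2) → ℕ) j.succ)) =
      ∏ j : Fin (n + 1), ∏ k ∈ Icc (eps4 a j) (m + 1),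
        (1 + b * q ^ (m + s) * q ^ ((j : ℕ) * m + k + a j)) := by
    rw [Fin.prod_univ_succ, Fin.prod_univ_succ, ← mul_assoc]
    congr 1
    · have e1 : eps4 (Fin.cons s fun i => s + a i : Fin (n + 2) → ℕ) (Fin.succ 0) =
          if a 0 = 0 then 2 else 1 := by
        simp [eps4]
      have e2 : eps4 a 0 = 1 := by simp [eps4]
      rw [e1, e2]
      split_ifs with h
      · rw [← mul_prod_Ioc_eq_prod_Icc (a := 1) (by omega), h]
        congr 1
        · simp
        · refine prod_congr (by ext; simp; omega) fun k _ => ?_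
          simp [h]
          ring
      · rw [one_mul]
        refine prod_congr rfl fun k _ => ?_
        simp
        ring
    · refine prod_congr rfl fun j _ => ?_
      have e1 : eps4 (Fin.cons s fun i => s + a i : Fin (n + 2) → ℕ) j.succ.succ =
          eps4 a j.succ := by
        have h (h' : j.1 + 1 < n + 2) :
            (⟨j.1 + 1, h'⟩ : Fin (n + 2)) = (⟨j.1, by omega⟩ : Fin (n + 1)).succ := rfl
        simp only [eps4, Fin.val_succ, Nat.add_sub_cancel, Nat.succ_ne_zero, dite_false, h,
          Fin.cons_succ, Nat.add_left_cancel_iff]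
      rw [e1]
      refine prod_congr rfl fun k _ => ?_
      simp
      ring
  rw [tupleTerm, tupleTerm, hexp, Fin.prod_univ_succ, hhead, ← htail, pow_add,
    mul_div_mul_comm, ← mul_div_assoc (ite _ _ _), mul_div_mul_left _ _ hw]

lemma summable_ite_mul_tupleTerm {q : ℂ} (hq : ‖q‖ < 1) (c : ℂ) {m : ℕ} (hm : 0 < m) (n : ℕ) :
    Summable fun p : ℕ × {a : Fin n → ℕ // Monotone a} =>
      (if p.1 = 0 then 1 + c * q else 1) *
        tupleTerm q c m (Fin.cons p.1 fun i => p.1 + p.2.1 i : Fin (n + 1) → ℕ) := by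
  have h : Summable fun p : ℕ × {a : Fin n → ℕ // Monotone a} =>
      tupleTerm q c m (Fin.cons p.1 fun i => p.1 + p.2.1 i : Fin (n + 1) → ℕ) :=
    (summable_tupleTerm hq c hm (n + 1)).comp_injective
      (Subtype.val_injective.comp (monotoneConsEquiv n).injective)
  refine (h.add ((h.indicator {p | p.1 = 0}).mul_left (c * q))).congr fun p => ?_
  by_cases hp : p.1 = 0 <;> simp [Set.indicator, hp, add_mul]

lemma tsum_ite_mul_pow_div_qPoch {q c : ℂ} (hq : ‖q‖ < 1)
    (hc : ∀ N : ℕ, 0 < N → 1 + c * q ^ N ≠ 0) {m : ℕ} (hm : 0 < m) (n : ℕ) :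
    ∑' t : ℕ, (if t = 0 then 1 + c * q else 1) * (q ^ (m * (n + 1) * t) /
      (qPoch (q ^ m) (q ^ m) n * qPoch (-(c * q ^ t * q)) q (m * (n + 1) + 1))) =
      (1 + c * q) / (qPoch (q ^ m) (q ^ m) (n + 1) * qPoch (-(c * q)) q (m * (n + 1) + 1)) := by
  have hM : 0 < m * (n + 1) := by positivity
  set M := m * (n + 1) with hM_def
  have h := hasSum_pow_div_qPoch hq hc hM
  have h' := (h.add (hasSum_ite_eq (0 : ℕ) (c * q / qPoch (-(c * q)) q (M + 1)))).mul_left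
    (qPoch (q ^ m) (q ^ m) n)⁻¹
  have h1 := one_sub_pow_ne_zero hq hM
  have h2 := qPoch_pow_ne_zero hq hm n
  have h3 := qPoch_ne_zero hc M
  have h4 : 1 - -(c * q) * q ^ M ≠ 0 := by
    have := hc (M + 1) M.succ_pos
    contrapose! this
    rw [← this]
    ring
  have h5 : 1 - q ^ m * (q ^ m) ^ n = 1 - q ^ M := by
    rw [← pow_succ', ← pow_mul]
  refine Eq.trans (tsum_congr fun t => ?_) (h'.tsum_eq.trans ?_)
  · have h6 := qPoch_ne_zero (one_add_mul_pow_shift hc t) (M + 1)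
    have h7 := qPoch_ne_zero hc (M + 1)
    split_ifs with ht
    · subst ht
      simp only [mul_zero, pow_zero, mul_one]
      field_simp
    · field_simp
      ring
  · rw [qPoch_succ (q ^ m), h5, qPoch_succ (-(c * q))]
    generalize hX : 1 - -(c * q) * q ^ M = X at h4 ⊢
    field_simp
    linear_combination -hX

/-- The sum over the tuples with prescribed first entry. -/
lemma tsum_tupleTerm_cons {q b : ℂ} (hq : ‖q‖ < 1) (hb : ∀ N : ℕ, 0 < N → 1 + b * q ^ N ≠ 0)
    {m : ℕ} (hm : 0 < m) (n s : ℕ) :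
    ∑' a : {a : Fin n → ℕ // Monotone a},
        tupleTerm q b m (Fin.cons s fun i => s + a.1 i : Fin (n + 1) → ℕ) =
      q ^ (m * (n + 1) * s) /
        (qPoch (q ^ m) (q ^ m) n * qPoch (-(b * q ^ s * q)) q (m * (n + 1) + 1)) := by
  induction n generalizing b s with
  | zero =>
    have : Unique {a : Fin 0 → ℕ // Monotone a} :=
      { default := ⟨Fin.elim0, fun i => i.elim0⟩
        uniq := fun a => Subtype.ext (Subsingleton.elim _ _) }
    rw [tsum_fintype, Fintype.sum_unique, tupleTerm, ← prod_Icc_eq_qPoch]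
    simp [eps4, qPoch]
  | succ n ih =>
    set c := b * q ^ (m + s) with hc_def
    have hc : ∀ N : ℕ, 0 < N → 1 + c * q ^ N ≠ 0 := one_add_mul_pow_shift hb (m + s)
    set M := m * (n + 1) with hM_def
    have hsum := summable_ite_mul_tupleTerm hq c hm n
    have hmain := tsum_ite_mul_pow_div_qPoch hq hc hm n
    rw [← hM_def] at hmain
    have hcons (a : {a : Fin (n + 1) → ℕ // Monotone a}) := tupleTerm_cons hb m n s a.1
    rw [tsum_congr hcons, tsum_mul_left, ← (monotoneConsEquiv n).tsum_eq]
    simp only [monotoneConsEquiv, Equiv.coe_fn_mk, Fin.cons_zero]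
    rw [hsum.tsum_prod.trans ((tsum_congr fun t => tsum_mul_left.trans
      (congrArg ((if t = 0 then 1 + c * q else 1) * ·) (ih hc t))).trans hmain)]
    have e1 : m * (n + 1 + 1) + 1 = (m + 1) + M := by
      rw [hM_def]
      ring
    have e2 : -(b * q ^ s * q) * q ^ (m + 1) = -(c * q * q) := by
      rw [hc_def]
      ring
    have e3 : qPoch (-(c * q)) q (M + 1) = (1 + c * q) * qPoch (-(c * q * q)) q M := by
      rw [add_comm, qPoch_add]
      simp [qPoch]
    have h1 : 1 + c * q ≠ 0 := by simpa using hc 1 one_pos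
    rw [e1, qPoch_add _ _ (m + 1) M, e2, e3, mul_left_comm _ (1 + c * q), div_mul_eq_div_div,
      div_self h1, div_mul_div_comm, mul_one]
    congr 1
    ring

/-- Lemma 3.2: for `0 < |q| < 1`, `b` with `1 + b q^N ≠ 0` for all
positive integers `N`, and positive integers `m`, `n`, the sum over all weakly
increasing `n`-tuples `(a_1,…,a_n)` of nonnegative integers of
`q^{m(a_1+⋯+a_n)} / ∏_{j=1}^n ∏_{k=ε_j}^{m+1} (1 + b q^{(j-1)m+k+a_j})`
converges absolutely and equals `1 / ((q^m; q^m)_n (−bq; q)_{mn})`. -/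
theorem lemma_sum_two (q b : ℂ) (hq0 : 0 < ‖q‖) (hq1 : ‖q‖ < 1)
    (hb : ∀ N : ℕ, 0 < N → 1 + b * q ^ N ≠ 0) (m n : ℕ) (hm : 0 < m) (hn : 0 < n) :
    Summable (fun a : {a : Fin n → ℕ // Monotone a} =>
      q ^ (m * ∑ j, a.1 j) /
        ∏ j : Fin n, ∏ k ∈ Finset.Icc (eps4 a.1 j) (m + 1),
          (1 + b * q ^ ((j : ℕ) * m + k + a.1 j))) ∧
    ∑' a : {a : Fin n → ℕ // Monotone a},
      q ^ (m * ∑ j, a.1 j) /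
        ∏ j : Fin n, ∏ k ∈ Finset.Icc (eps4 a.1 j) (m + 1),
          (1 + b * q ^ ((j : ℕ) * m + k + a.1 j)) =
      1 / (qPoch (q ^ m) (q ^ m) n * qPoch (-(b * q)) q (m * n)) := by
  have hsum : Summable fun a : {a : Fin n → ℕ // Monotone a} => tupleTerm q b m a.1 :=
    (summable_tupleTerm hq1 b hm n).subtype _
  refine ⟨hsum, ?_⟩
  obtain ⟨n, rfl⟩ := Nat.exists_eq_succ_of_ne_zero hn.ne'
  change ∑' a : {a : Fin (n + 1) → ℕ // Monotone a}, tupleTerm q b m a.1 = _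
  have hM : 0 < m * (n + 1) := by positivity
  have h := (hasSum_pow_div_qPoch hq1 hb hM).mul_left (qPoch (q ^ m) (q ^ m) n)⁻¹
  calc _ = ∑' p, ((fun a : {a : Fin (n + 1) → ℕ // Monotone a} => tupleTerm q b m a.1) ∘
        monotoneConsEquiv n) p := ((monotoneConsEquiv n).tsum_eq _).symm
    _ = ∑' s, (qPoch (q ^ m) (q ^ m) n)⁻¹ *
        (q ^ (m * (n + 1) * s) / qPoch (-(b * q ^ s * q)) q (m * (n + 1) + 1)) := by
      rw [((monotoneConsEquiv n).summable_iff.2 hsum).tsum_prod]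
      refine tsum_congr fun s => (tsum_tupleTerm_cons hq1 hb hm n s).trans ?_
      rw [div_mul_eq_div_div_swap, div_eq_inv_mul]
    _ = _ := by
      rw [h.tsum_eq, Nat.succ_eq_add_one, qPoch_succ (q ^ m), ← pow_succ', ← pow_mul, one_div,
        one_div, ← mul_inv, mul_assoc]
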